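/- There exists a subgroup G ≤ W isomorphic to the dihedral group of order 20 such that: the action of G on the 240 exceptional classes has exactly 23 orbits, with orbit-length multiset consisting of four orbits of length 2, three of length 4, four of length 5, four of length 10, and eight of length 20; G is minimal; G fixes a conic class; and G satisfies condition (H1). -/

import Mathlib

open scoped BigOperators

noncomputable section

/-- The Picard lattice of a degree 1 del Pezzo surface. -/
abbrev V : Type := Fin 9 → ℤ

/-- The intersection form. -/
def bil (x y : V) : ℤ := x 0 * y 0 - ∑ i ∈ Finset.Ioi (0 : Fin 9), x i * y i

/-- The canonical class. -/
def Kvec : V := fun i => if i = 0 then -3 else 1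

abbrev LatAut := V ≃ₗ[ℤ] V

/-- The Weyl group: automorphisms preserving the form and fixing K. -/
def W : Subgroup LatAut where
  carrier := {g | (∀ x y, bil (g x) (g y) = bil x y) ∧ g Kvec = Kvec}
  one_mem' := ⟨fun _ _ => rfl, rfl⟩
  mul_mem' := by
    rintro a b ⟨ha1, ha2⟩ ⟨hb1, hb2⟩
    refine ⟨fun x y => ?_, ?_⟩
    · show bil (a (b x)) (a (b y)) = bil x y
      rw [ha1, hb1]
    · show a (b Kvec) = Kvec
      rw [hb2, ha2]
  inv_mem' := by
    rintro a ⟨ha1, ha2⟩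
    refine ⟨fun x y => ?_, ?_⟩
    · have h := ha1 (a⁻¹ x) (a⁻¹ y)
      have hx : a (a⁻¹ x) = x := a.apply_symm_apply x
      have hy : a (a⁻¹ y) = y := a.apply_symm_apply y
      rw [hx, hy] at h
      exact h.symm
    · have h2 : a.symm (a Kvec) = a.symm Kvec := by rw [ha2]
      rw [a.symm_apply_apply] at h2
      exact (show a⁻¹ Kvec = a.symm Kvec from rfl).trans h2.symm

/-- Exceptional classes. -/
def Exc : Set V := {E | bil E E = -1 ∧ bil E Kvec = -1}

/-- Conic classes. -/
def IsConic (C : V) : Prop := bil C C = 0 ∧ bil C Kvec = -2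

/-- The orbit of a vector under a subgroup of `LatAut`. -/
def orb (G : Subgroup LatAut) (E : V) : Set V := {v | ∃ g ∈ G, g E = v}

/-- The set of orbits of exceptional classes. -/
def orbs (G : Subgroup LatAut) : Set (Set V) := {S | ∃ E ∈ Exc, S = orb G E}

/-- The stabilizer of a vector, as a subgroup of `LatAut`. -/
def stab (G : Subgroup LatAut) (E : V) : Subgroup LatAut where
  carrier := {g | g ∈ G ∧ g E = E}
  one_mem' := ⟨G.one_mem, rfl⟩
  mul_mem' := by
    rintro a b ⟨haG, ha⟩ ⟨hbG, hb⟩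
    exact ⟨G.mul_mem haG hbG, by show a (b E) = E; rw [hb, ha]⟩
  inv_mem' := by
    rintro a ⟨haG, ha⟩
    refine ⟨G.inv_mem haG, ?_⟩
    conv_lhs => rw [← ha]
    exact a.symm_apply_apply E

/-- `G` is minimal: no nonempty orbit of exceptional classes consists of pairwise
orthogonal classes. -/
def MinimalAction (G : Subgroup LatAut) : Prop :=
  ∀ E ∈ Exc, ¬ (∀ E₁ ∈ orb G E, ∀ E₂ ∈ orb G E, E₁ ≠ E₂ → bil E₁ E₂ = 0)

/-- The natural representation of a subgroup of `LatAut` on the lattice. -/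
def rep (G : Subgroup LatAut) : Representation ℤ G V where
  toFun g := (g : LatAut).toLinearMap
  map_one' := rfl
  map_mul' _ _ := rfl

/-- Condition (H1): the first group cohomology of every subgroup of `G`
with coefficients in the lattice vanishes. -/
def CondH1 (G : Subgroup LatAut) : Prop :=
  ∀ G' : Subgroup LatAut, G' ≤ G →
    Subsingleton (groupCohomology.H1 (Rep.of (rep G')))

theorem bil_eq_sum (x y : V) : bil x y = x 0 * y 0 - (x 1 * y 1 + x 2 * y 2 + x 3 * y 3 +
    x 4 * y 4 + x 5 * y 5 + x 6 * y 6 + x 7 * y 7 + x 8 * y 8) := by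
  have h : Finset.Ioi (0 : Fin 9) = {1, 2, 3, 4, 5, 6, 7, 8} := by decide
  simp [bil, h, add_assoc]

theorem bil_add_right (x y z : V) : bil x (y + z) = bil x y + bil x z := by
  simp only [bil_eq_sum, Pi.add_apply]; ring

theorem bil_nsmul_right (n : ℕ) (x y : V) : bil x (n • y) = n * bil x y := by
  have h : ∀ i, (n • y) i = n * y i := fun i => by rw [Pi.smul_apply, nsmul_eq_mul]
  simp only [bil_eq_sum, h]; ring

/-- If the identity of the lattice factors through a permutation module of `G`, given by a stable
family `P` of pairs `(a, b)` with `∑ ⟨b, x⟩ a = x`, then all first cohomology groups vanish. -/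
theorem condH1_of_reproducing (G : Subgroup LatAut) [Finite G] (P : Multiset (V × V))
    (hW : G ≤ W) (hP : ∀ g ∈ G, P.map (Prod.map g g) = P)
    (hrep : ∀ x, (P.map fun p => bil p.2 x • p.1).sum = x) : CondH1 G := by
  intro G' hG'
  have : Finite G' := Finite.of_injective _ (Subgroup.inclusion_injective hG')
  have := Fintype.ofFinite G'
  refine ⟨fun x y => ?_⟩
  suffices h : ∀ z : groupCohomology.H1 (Rep.of (rep G')), z = 0 by rw [h x, h y]
  intro z
  induction z using groupCohomology.H1_induction_on with
  | h f =>
  rw [groupCohomology.H1π_eq_zero_iff]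
  have hf : ∀ g h : G', (f (g * h) : V) = (g : LatAut) (f h) + f g :=
    (groupCohomology.mem_cocycles₁_iff (A := Rep.of (rep G')) f).1 f.2
  set n : ℕ := Fintype.card G' with hn
  have hn0 : (n : ℤ) ≠ 0 := by exact_mod_cast Fintype.card_ne_zero
  let m : V := ∑ h : G', (f h : V)
  have hm : ∀ g : G', m = (g : LatAut) m + n • (f g : V) := fun g => by
    calc m = ∑ h : G', (f (g * h) : V) := (Equiv.sum_comp (Equiv.mulLeft g) fun h => (f h : V)).symm
      _ = _ := by
        simp only [hf, Finset.sum_add_distrib, m, map_sum, Finset.sum_const, Finset.card_univ, hn]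
  let q : V → V := fun x => (P.map fun p => (bil p.2 x / n) • p.1).sum
  have hq : ∀ g : G', (g : LatAut) (q m) = q ((g : LatAut) m) := fun g => by
    have hg := (hW (hG' g.2)).1
    simp only [q]
    rw [map_multiset_sum, Multiset.map_map]
    conv_rhs => rw [← hP _ (hG' g.2), Multiset.map_map]
    congr 1
    refine Multiset.map_congr rfl fun p _ => ?_
    simp only [Function.comp_apply, Prod.map_fst, Prod.map_snd, map_zsmul, hg]
  refine ⟨-q m, ?_⟩
  funext g
  change (g : LatAut) (-q m) - (-q m) = (f g : V)
  have hsplit : q m = q ((g : LatAut) m) + f g := by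
    conv_rhs => rw [← hrep (f g)]
    simp only [q]
    rw [← Multiset.sum_map_add]
    congr 1
    refine Multiset.map_congr rfl fun p _ => ?_
    conv_lhs => rw [hm g, bil_add_right, bil_nsmul_right, Int.add_mul_ediv_left _ _ hn0]
    rw [add_smul]
  rw [map_neg, hq, hsplit]
  abel

/-- The rotation of order ten on vectors. -/
def rotFun (v : V) : V :=
  ![2 * v 0 + v 1 + v 7 + v 8, -v 0 - v 7 - v 8, v 6, v 2, v 3, v 4, v 5,
    -v 0 - v 1 - v 7, -v 0 - v 1 - v 8]

/-- The inverse of the rotation of order ten on vectors. -/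
def rotInvFun (v : V) : V :=
  ![2 * v 0 + v 1 + v 7 + v 8, -v 0 - v 7 - v 8, v 3, v 4, v 5, v 6, v 2,
    -v 0 - v 1 - v 7, -v 0 - v 1 - v 8]

/-- The reflection on vectors. -/
def reflFun (v : V) : V :=
  ![4 * v 0 + 3 * v 1 + (v 2 + v 3 + v 4 + v 5 + v 6) + v 8,
    -3 * v 0 - 2 * v 1 - (v 2 + v 3 + v 4 + v 5 + v 6) - v 8,
    -v 0 - v 1 - v 2, -v 0 - v 1 - v 6, -v 0 - v 1 - v 5, -v 0 - v 1 - v 4, -v 0 - v 1 - v 3,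
    v 7, -v 0 - v 1 - v 8]

/-- The rotation of order ten. -/
def rotAut : LatAut where
  toFun := rotFun
  invFun := rotInvFun
  map_add' x y := by ext i; fin_cases i <;> simp [rotFun] <;> ring
  map_smul' c x := by ext i; fin_cases i <;> simp [rotFun] <;> ring
  left_inv x := by ext i; fin_cases i <;> simp [rotFun, rotInvFun] <;> ring
  right_inv x := by ext i; fin_cases i <;> simp [rotFun, rotInvFun] <;> ring

/-- The reflection. -/
def reflAut : LatAut where
  toFun := reflFun
  invFun := reflFun
  map_add' x y := by ext i; fin_cases i <;> simp [reflFun] <;> ring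
  map_smul' c x := by ext i; fin_cases i <;> simp [reflFun] <;> ring
  left_inv x := by ext i; fin_cases i <;> simp [reflFun] <;> ring
  right_inv x := by ext i; fin_cases i <;> simp [reflFun] <;> ring

theorem rot_apply (v : V) : rotAut v = rotFun v := rfl

theorem refl_apply (v : V) : reflAut v = reflFun v := rfl

theorem rot_pow_five_apply (v : V) : (rotAut ^ 5) v =
    ![2 * v 0 + v 1 + v 7 + v 8, -v 0 - v 7 - v 8, v 2, v 3, v 4, v 5, v 6,
      -v 0 - v 1 - v 7, -v 0 - v 1 - v 8] := by
  simp only [pow_succ, pow_zero, one_mul, LinearEquiv.mul_apply, rot_apply]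
  ext i; fin_cases i <;> simp [rotFun] <;> ring

theorem rot_pow_ten : rotAut ^ 10 = 1 := by
  refine LinearEquiv.ext fun v => ?_
  rw [show 10 = 5 + 5 from rfl, pow_add]
  change (rotAut ^ 5) ((rotAut ^ 5) v) = v
  ext i; fin_cases i <;> simp [rot_pow_five_apply] <;> ring

theorem refl_mul_refl : reflAut * reflAut = 1 :=
  LinearEquiv.ext fun v => reflAut.left_inv v

theorem rot_mul_refl_mul_rot : rotAut * reflAut * rotAut = reflAut := by
  refine LinearEquiv.ext fun v => ?_
  change rotFun (reflFun (rotFun v)) = reflFun v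
  ext i; fin_cases i <;> simp [rotFun, reflFun] <;> ring

theorem Kvec_eq : Kvec = ![-3, 1, 1, 1, 1, 1, 1, 1, 1] := by
  ext i; fin_cases i <;> rfl

theorem rot_mem_W : rotAut ∈ W := by
  refine ⟨fun x y => ?_, ?_⟩
  · simp [bil_eq_sum, rot_apply, rotFun]; ring
  · rw [rot_apply, Kvec_eq]; ext i; fin_cases i <;> simp [rotFun]

theorem refl_mem_W : reflAut ∈ W := by
  refine ⟨fun x y => ?_, ?_⟩
  · simp [bil_eq_sum, refl_apply, reflFun]; ring
  · rw [refl_apply, Kvec_eq]; ext i; fin_cases i <;> simp [reflFun]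

theorem rot_pow_eq_of_cast_eq {a b : ℕ} (h : (a : ZMod 10) = b) : rotAut ^ a = rotAut ^ b := by
  rw [ZMod.natCast_eq_natCast_iff] at h
  rw [pow_eq_pow_mod a rot_pow_ten, pow_eq_pow_mod b rot_pow_ten, h]

theorem rot_pow_mul_refl_mul_rot_pow (k : ℕ) : rotAut ^ k * reflAut * rotAut ^ k = reflAut := by
  induction k with
  | zero => simp
  | succ k ih =>
    calc rotAut ^ (k + 1) * reflAut * rotAut ^ (k + 1)
        = rotAut ^ k * (rotAut * reflAut * rotAut) * rotAut ^ k := by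
          nth_rewrite 2 [pow_succ']; simp only [pow_succ, mul_assoc]
      _ = reflAut := by rw [rot_mul_refl_mul_rot, ih]

theorem rot_pow_mul_refl_mul_rot_pow_add (i j : ℕ) :
    rotAut ^ i * (reflAut * rotAut ^ (i + j)) = reflAut * rotAut ^ j := by
  rw [pow_add, ← mul_assoc, ← mul_assoc, rot_pow_mul_refl_mul_rot_pow]

/-- The action of the dihedral group of order 20 on the lattice. -/
def dihedralHom : DihedralGroup 10 →* LatAut :=
  MonoidHom.mk'
    (fun
      | .r i => rotAut ^ i.val
      | .sr i => reflAut * rotAut ^ i.val) (by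
    have key (i j : ZMod 10) : rotAut ^ j.val = rotAut ^ (i.val + (j - i).val) :=
      rot_pow_eq_of_cast_eq (by simp)
    rintro (i | i) (j | j)
    · rw [DihedralGroup.r_mul_r]
      dsimp only
      rw [← pow_add]
      exact rot_pow_eq_of_cast_eq (by simp)
    · rw [DihedralGroup.r_mul_sr]
      dsimp only
      rw [key i j, rot_pow_mul_refl_mul_rot_pow_add]
    · rw [DihedralGroup.sr_mul_r]
      dsimp only
      rw [mul_assoc, ← pow_add]
      exact congrArg (reflAut * ·) (rot_pow_eq_of_cast_eq (by simp))
    · rw [DihedralGroup.sr_mul_sr]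
      dsimp only
      rw [key i j, mul_assoc, rot_pow_mul_refl_mul_rot_pow_add, ← mul_assoc, refl_mul_refl,
        one_mul])

theorem dihedralHom_r (i : ZMod 10) : dihedralHom (.r i) = rotAut ^ i.val := rfl

theorem dihedralHom_sr (i : ZMod 10) : dihedralHom (.sr i) = reflAut * rotAut ^ i.val := rfl

theorem range_dihedralHom_le (H : Subgroup LatAut) (hr : rotAut ∈ H) (hs : reflAut ∈ H) :
    dihedralHom.range ≤ H := by
  rintro _ ⟨i | i, rfl⟩
  · exact H.pow_mem hr _
  · exact H.mul_mem hs (H.pow_mem hr _)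

/-- Nine integers, a form of lattice vectors suited to evaluation. -/
abbrev Coords : Type := ℤ × ℤ × ℤ × ℤ × ℤ × ℤ × ℤ × ℤ × ℤ

instance : DecidableEq Coords :=
  let _ : DecidableEq (ℤ × ℤ × ℤ × ℤ) := inferInstance
  let _ : DecidableEq (ℤ × ℤ × ℤ × ℤ × ℤ × ℤ) := inferInstance
  inferInstance

/-- The lattice vector with given coordinates. -/
def toVec : Coords → V
  | (a, b, c, d, e, f, g, h, i) => ![a, b, c, d, e, f, g, h, i]

/-- The rotation in coordinates. -/
def rotCoords : Coords → Coords
  | (a, b, c, d, e, f, g, h, i) =>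
    (2 * a + b + h + i, -a - h - i, g, c, d, e, f, -a - b - h, -a - b - i)

/-- The reflection in coordinates. -/
def reflCoords : Coords → Coords
  | (a, b, c, d, e, f, g, h, i) =>
    (4 * a + 3 * b + (c + d + e + f + g) + i, -3 * a - 2 * b - (c + d + e + f + g) - i,
      -a - b - c, -a - b - g, -a - b - f, -a - b - e, -a - b - d, h, -a - b - i)

/-- The intersection form in coordinates. -/
def bilCoords : Coords → Coords → ℤ
  | (a, b, c, d, e, f, g, h, i), (a₁, b₁, c₁, d₁, e₁, f₁, g₁, h₁, i₁) =>
    a * a₁ - (b * b₁ + c * c₁ + d * d₁ + e * e₁ + f * f₁ + g * g₁ + h * h₁ + i * i₁)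

theorem toVec_injective : Function.Injective toVec := by
  rintro ⟨a, b, c, d, e, f, g, h, i⟩ ⟨a₁, b₁, c₁, d₁, e₁, f₁, g₁, h₁, i₁⟩ H
  simpa [toVec, funext_iff, Fin.forall_fin_succ] using H

theorem rotAut_toVec (t : Coords) : rotAut (toVec t) = toVec (rotCoords t) := by
  ext i; fin_cases i <;> rfl

theorem reflAut_toVec (t : Coords) : reflAut (toVec t) = toVec (reflCoords t) := by
  ext i; fin_cases i <;> rfl

theorem bil_toVec (t u : Coords) : bil (toVec t) (toVec u) = bilCoords t u := by
  rw [bil_eq_sum]; rfl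

theorem rotAut_pow_toVec (k : ℕ) (t : Coords) :
    (rotAut ^ k) (toVec t) = toVec (rotCoords^[k] t) := by
  induction k generalizing t with
  | zero => rfl
  | succ k ih => rw [pow_succ, LinearEquiv.mul_apply, rotAut_toVec, ih, Function.iterate_succ_apply]

/-- The images of a vector under the twenty elements of the group. -/
def images (t : Coords) : List Coords :=
  (List.range 10).flatMap fun k => [rotCoords^[k] t, reflCoords (rotCoords^[k] t)]

theorem mem_images {t u : Coords} :
    u ∈ images t ↔ ∃ k < 10, u = rotCoords^[k] t ∨ u = reflCoords (rotCoords^[k] t) := by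
  simp [images]

theorem orb_toVec (t : Coords) :
    orb dihedralHom.range (toVec t) = toVec '' (images t).toFinset := by
  ext v
  simp only [Set.mem_image, SetLike.mem_coe, List.mem_toFinset, mem_images]
  constructor
  · rintro ⟨_, ⟨i | i, rfl⟩, rfl⟩
    · exact ⟨_, ⟨i.val, i.val_lt, .inl rfl⟩, (rotAut_pow_toVec _ _).symm⟩
    · refine ⟨_, ⟨i.val, i.val_lt, .inr rfl⟩, ?_⟩
      rw [dihedralHom_sr, LinearEquiv.mul_apply, rotAut_pow_toVec, reflAut_toVec]
  · rintro ⟨_, ⟨k, hk, rfl | rfl⟩, rfl⟩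
    · refine ⟨_, ⟨.r k, rfl⟩, ?_⟩
      rw [dihedralHom_r, ZMod.val_natCast_of_lt hk, rotAut_pow_toVec]
    · refine ⟨_, ⟨.sr k, rfl⟩, ?_⟩
      rw [dihedralHom_sr, ZMod.val_natCast_of_lt hk, LinearEquiv.mul_apply, rotAut_pow_toVec,
        reflAut_toVec]

theorem ncard_orb_toVec (t : Coords) :
    (orb dihedralHom.range (toVec t)).ncard = (images t).toFinset.card := by
  rw [orb_toVec, Set.ncard_image_of_injective _ toVec_injective, Set.ncard_coe_finset]

theorem dihedralHom_injective : Function.Injective dihedralHom := by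
  rw [injective_iff_map_eq_one]
  have key : ∀ k < 10, (rotCoords^[k] (1, 0, 0, 0, -1, 0, -1, 0, 0) = (1, 0, 0, 0, -1, 0, -1, 0, 0)
      → k = 0) ∧ reflCoords (rotCoords^[k] (1, 0, 0, 0, -1, 0, -1, 0, 0)) ≠
        (1, 0, 0, 0, -1, 0, -1, 0, 0) := by
    decide +kernel
  rintro (i | i) h
  · have h' := LinearEquiv.congr_fun h (toVec (1, 0, 0, 0, -1, 0, -1, 0, 0))
    rw [dihedralHom_r, rotAut_pow_toVec] at h'
    rw [(ZMod.val_eq_zero i).1 ((key _ i.val_lt).1 (toVec_injective h'))]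
    rfl
  · have h' := LinearEquiv.congr_fun h (toVec (1, 0, 0, 0, -1, 0, -1, 0, 0))
    rw [dihedralHom_sr, LinearEquiv.mul_apply, rotAut_pow_toVec, reflAut_toVec] at h'
    exact absurd (toVec_injective h') (key _ i.val_lt).2

/-- Representatives of the orbits of exceptional classes. -/
def reps : List Coords :=
  [(0, 0, 0, 0, 0, 0, 0, 0, 1),
   (0, 0, 0, 0, 0, 0, 0, 1, 0),
   (5, -1, -2, -2, -2, -2, -2, -2, -1),
   (5, -1, -2, -2, -2, -2, -2, -1, -2),
   (0, 1, 0, 0, 0, 0, 0, 0, 0),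
   (2, 0, -1, -1, -1, -1, -1, 0, 0),
   (3, 0, -1, -1, -1, -1, -1, -1, -2),
   (3, -1, 0, -2, -1, -1, -1, -1, -1),
   (3, -1, 0, -1, -2, -1, -1, -1, -1),
   (3, -1, 0, -1, -1, -2, -1, -1, -1),
   (3, -1, 0, -1, -1, -1, -2, -1, -1),
   (0, 0, 1, 0, 0, 0, 0, 0, 0),
   (2, 0, 0, -1, 0, -1, -1, -1, -1),
   (2, 0, 0, 0, -1, -1, -1, -1, -1),
   (5, -1, -1, -2, -2, -2, -2, -2, -2),
   (1, 0, 0, 0, -1, 0, -1, 0, 0),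
   (1, 0, 0, 0, 0, -1, -1, 0, 0),
   (1, 0, 0, 0, 0, 0, -1, 0, -1),
   (2, 0, 0, -1, -1, -1, -1, -1, 0),
   (2, 0, 0, -1, -1, -1, -1, 0, -1),
   (3, 0, -1, -1, -1, -1, -2, -1, -1),
   (4, -1, -1, -1, -2, -1, -2, -1, -2),
   (4, -1, -1, -1, -1, -2, -2, -1, -2)]

theorem reps_exceptional : ∀ t ∈ reps, bilCoords t t = -1 ∧
    bilCoords t (-3, 1, 1, 1, 1, 1, 1, 1, 1) = -1 := by
  decide +kernel

theorem reps_inequivalent : ∀ t ∈ reps, ∀ u ∈ reps, t ∈ images u → t = u := by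
  decide +kernel

theorem reps_not_orthogonal : ∀ t ∈ reps, ∃ u ∈ images t, u ≠ t ∧ bilCoords u t ≠ 0 := by
  decide +kernel

/-- The integer lists with given length, sum and sum of squares, all entries being at most seven in
absolute value. -/
def listsWithSums : ℕ → ℤ → ℤ → List (List ℤ)
  | 0, s, q => if s = 0 ∧ q = 0 then [[]] else []
  | n + 1, s, q =>
    if (n + 1 : ℕ) * q < s ^ 2 then [] else
      [-7, -6, -5, -4, -3, -2, -1, 0, 1, 2, 3, 4, 5, 6, 7].flatMap fun x =>
        (listsWithSums n (s - x) (q - x ^ 2)).map (x :: ·)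

theorem sq_sum_le_length_mul (l : List ℤ) : l.sum ^ 2 ≤ l.length * (l.map (· ^ 2)).sum := by
  have h := sq_sum_le_card_mul_sum_sq (s := Finset.univ) (f := fun i : Fin l.length => l[i])
  have h1 := Fin.sum_univ_fun_getElem l id
  have h2 := Fin.sum_univ_fun_getElem l (· ^ 2)
  simp only [List.map_id, id] at h1
  simpa only [Fin.getElem_fin, h1, h2, Finset.card_univ, Fintype.card_fin] using h

theorem mem_listsWithSums (l : List ℤ) (hl : ∀ x ∈ l, x ^ 2 ≤ 50) :
    l ∈ listsWithSums l.length l.sum (l.map (· ^ 2)).sum := by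
  induction l with
  | nil => simp [listsWithSums]
  | cons x l ih =>
    have hx : x ^ 2 ≤ 50 := hl x (by simp)
    have h1 : -7 ≤ x := by nlinarith
    have h2 : x ≤ 7 := by nlinarith
    have h := sq_sum_le_length_mul (x :: l)
    rw [List.length_cons, listsWithSums, if_neg (by simpa using h), List.mem_flatMap]
    refine ⟨x, by interval_cases x <;> simp, ?_⟩
    simpa using ih fun y hy => hl y (by simp [hy])

/-- Nine coordinates from a first coordinate and a list of eight. -/
def ofList (a : ℤ) : List ℤ → Coords
  | [b, c, d, e, f, g, h, i] => (a, b, c, d, e, f, g, h, i)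
  | _ => 0

/-- A list of coordinates that contains those of every exceptional class. -/
def candidates : List Coords :=
  [-1, 0, 1, 2, 3, 4, 5, 6, 7].flatMap fun a =>
    (listsWithSums 8 (1 - 3 * a) (a ^ 2 + 1)).map (ofList a)

theorem length_candidates : candidates.length = 240 := by
  decide +kernel

theorem sum_card_images : ∑ t ∈ reps.toFinset, (images t).toFinset.card = 240 := by
  decide +kernel

theorem orb_eq_of_mem {G : Subgroup LatAut} {u v : V} (h : u ∈ orb G v) : orb G u = orb G v := by
  obtain ⟨g, hg, rfl⟩ := h
  ext w
  constructor
  · rintro ⟨k, hk, rfl⟩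
    exact ⟨k * g, G.mul_mem hk hg, rfl⟩
  · rintro ⟨k, hk, rfl⟩
    exact ⟨k * g⁻¹, G.mul_mem hk (G.inv_mem hg), congrArg k (g.symm_apply_apply v)⟩

theorem self_mem_orb (G : Subgroup LatAut) (v : V) : v ∈ orb G v := ⟨1, G.one_mem, rfl⟩

theorem Kvec_eq_toVec : Kvec = toVec (-3, 1, 1, 1, 1, 1, 1, 1, 1) := Kvec_eq

theorem Exc_subset_candidates : Exc ⊆ toVec '' candidates.toFinset := by
  rintro E ⟨h1, h2⟩
  rw [bil_eq_sum] at h1 h2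
  simp only [Kvec_eq, Matrix.cons_val] at h2
  let l : List ℤ := [E 1, E 2, E 3, E 4, E 5, E 6, E 7, E 8]
  have hsum : l.sum = 1 - 3 * E 0 := by
    simp only [l, List.sum_cons, List.sum_nil]; linarith
  have hsq : (l.map (· ^ 2)).sum = E 0 ^ 2 + 1 := by
    simp only [l, List.map_cons, List.map_nil, List.sum_cons, List.sum_nil]; linarith
  have hcs := sq_sum_le_length_mul l
  rw [hsum, hsq, show l.length = 8 from rfl] at hcs
  push_cast at hcs
  have hlo : -1 ≤ E 0 := by nlinarith
  have hhi : E 0 ≤ 7 := by nlinarith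
  have hsmall : ∀ x ∈ l, x ^ 2 ≤ 50 := fun x hx => by
    have : x ^ 2 ≤ (l.map (· ^ 2)).sum :=
      List.single_le_sum (by simp [sq_nonneg]) _ (List.mem_map_of_mem hx)
    nlinarith
  have hl := mem_listsWithSums l hsmall
  rw [hsum, hsq] at hl
  have ha : E 0 ∈ [-1, 0, 1, 2, 3, 4, 5, 6, 7] := by
    generalize E 0 = a at hlo hhi
    interval_cases a <;> simp
  refine ⟨ofList (E 0) l, List.mem_toFinset.2 (List.mem_flatMap.2
    ⟨E 0, ha, List.mem_map_of_mem hl⟩), ?_⟩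
  ext i; fin_cases i <;> rfl

theorem toVec_mem_Exc {t : Coords} (ht : t ∈ reps) : toVec t ∈ Exc := by
  refine ⟨?_, ?_⟩
  · rw [bil_toVec]; exact (reps_exceptional t ht).1
  · rw [Kvec_eq_toVec, bil_toVec]; exact (reps_exceptional t ht).2

theorem orb_subset_Exc {G : Subgroup LatAut} (hG : G ≤ W) {E : V} (hE : E ∈ Exc) :
    orb G E ⊆ Exc := by
  rintro _ ⟨g, hg, rfl⟩
  obtain ⟨h1, h2⟩ := hG hg
  refine ⟨(h1 E E).trans hE.1, ?_⟩
  rw [← hE.2, ← h1 E Kvec, h2]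

theorem range_dihedralHom_le_W : dihedralHom.range ≤ W :=
  range_dihedralHom_le W rot_mem_W refl_mem_W

theorem toVec_mem_orb_iff {t u : Coords} :
    toVec u ∈ orb dihedralHom.range (toVec t) ↔ u ∈ images t := by
  rw [orb_toVec, toVec_injective.mem_set_image, Finset.mem_coe, List.mem_toFinset]

theorem eq_of_orb_eq {t u : Coords} (ht : t ∈ reps) (hu : u ∈ reps)
    (h : orb dihedralHom.range (toVec t) = orb dihedralHom.range (toVec u)) : t = u := by
  refine reps_inequivalent t ht u hu (toVec_mem_orb_iff.1 ?_)
  rw [← h]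
  exact self_mem_orb _ _

theorem Exc_eq : Exc = toVec '' (reps.toFinset.biUnion fun t => (images t).toFinset) := by
  symm
  refine Set.eq_of_subset_of_ncard_le ?_ ?_ ((Finset.finite_toSet _).image _ |>.subset
    Exc_subset_candidates)
  · rintro _ ⟨u, hu, rfl⟩
    obtain ⟨t, ht, hut⟩ := Finset.mem_biUnion.1 hu
    exact orb_subset_Exc range_dihedralHom_le_W (toVec_mem_Exc (List.mem_toFinset.1 ht))
      (toVec_mem_orb_iff.2 (List.mem_toFinset.1 hut))
  · rw [Set.ncard_image_of_injective _ toVec_injective, Set.ncard_coe_finset, Finset.card_biUnion,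
      sum_card_images, ← length_candidates]
    · refine (Set.ncard_le_ncard Exc_subset_candidates ((Finset.finite_toSet _).image _)).trans ?_
      rw [Set.ncard_image_of_injective _ toVec_injective, Set.ncard_coe_finset]
      exact List.toFinset_card_le _
    · intro t ht u hu hne
      refine Finset.disjoint_left.2 fun w hwt hwu => hne ?_
      rw [List.mem_toFinset, ← toVec_mem_orb_iff] at hwt hwu
      exact eq_of_orb_eq (List.mem_toFinset.1 ht) (List.mem_toFinset.1 hu)
        ((orb_eq_of_mem hwt).symm.trans (orb_eq_of_mem hwu))

theorem exists_rep_of_mem_Exc {E : V} (hE : E ∈ Exc) :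
    ∃ t ∈ reps, orb dihedralHom.range E = orb dihedralHom.range (toVec t) := by
  rw [Exc_eq] at hE
  obtain ⟨u, hu, rfl⟩ := hE
  obtain ⟨t, ht, hut⟩ := Finset.mem_biUnion.1 hu
  exact ⟨t, List.mem_toFinset.1 ht,
    orb_eq_of_mem (toVec_mem_orb_iff.2 (List.mem_toFinset.1 hut))⟩

theorem orbs_eq_image :
    orbs dihedralHom.range = (fun t => orb dihedralHom.range (toVec t)) '' reps.toFinset := by
  ext S
  constructor
  · rintro ⟨E, hE, rfl⟩
    obtain ⟨t, ht, h⟩ := exists_rep_of_mem_Exc hE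
    exact ⟨t, by simpa using ht, h.symm⟩
  · rintro ⟨t, ht, rfl⟩
    exact ⟨_, toVec_mem_Exc (by simpa using ht), rfl⟩

theorem orb_injOn_reps :
    Set.InjOn (fun t => orb dihedralHom.range (toVec t)) (reps.toFinset : Set Coords) := by
  intro t ht u hu h
  exact eq_of_orb_eq (List.mem_toFinset.1 ht) (List.mem_toFinset.1 hu) h

theorem ncard_orbs : (orbs dihedralHom.range).ncard = reps.toFinset.card := by
  rw [orbs_eq_image, orb_injOn_reps.ncard_image, Set.ncard_coe_finset]

theorem ncard_orbs_of_ncard (k : ℕ) : {S ∈ orbs dihedralHom.range | S.ncard = k}.ncard =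
    (reps.toFinset.filter fun t => (images t).toFinset.card = k).card := by
  have h : {S ∈ orbs dihedralHom.range | S.ncard = k} =
      (fun t => orb dihedralHom.range (toVec t)) ''
        (reps.toFinset.filter fun t => (images t).toFinset.card = k) := by
    rw [orbs_eq_image]
    ext S
    constructor
    · rintro ⟨⟨t, ht, rfl⟩, hS⟩
      exact ⟨t, Finset.mem_filter.2 ⟨ht, (ncard_orb_toVec t).symm.trans hS⟩, rfl⟩
    · rintro ⟨t, ht, rfl⟩
      obtain ⟨ht, hk⟩ := Finset.mem_filter.1 ht
      exact ⟨⟨t, ht, rfl⟩, (ncard_orb_toVec t).trans hk⟩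
  rw [h, (orb_injOn_reps.mono fun t ht => (Finset.mem_filter.1 ht).1).ncard_image,
    Set.ncard_coe_finset]

theorem minimalAction_dihedral : MinimalAction dihedralHom.range := by
  intro E hE h
  obtain ⟨t, ht, hEt⟩ := exists_rep_of_mem_Exc hE
  obtain ⟨u, hu, hne, hbil⟩ := reps_not_orthogonal t ht
  rw [hEt] at h
  refine hbil ?_
  rw [← bil_toVec]
  refine h _ ?_ _ (self_mem_orb _ _) (toVec_injective.ne hne)
  exact toVec_mem_orb_iff.2 hu

/-- The lattice automorphisms that permute a multiset of pairs of vectors. -/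
def pairStabilizer (P : Multiset (V × V)) : Subgroup LatAut where
  carrier := {g | P.map (Prod.map g g) = P}
  one_mem' := Multiset.map_id P
  mul_mem' {a b} ha hb := by
    change P.map (Prod.map a a ∘ Prod.map b b) = P
    rw [← Multiset.map_map, hb, ha]
  inv_mem' {a} ha := by
    change P.map (Prod.map a.symm a.symm) = P
    conv_lhs => rw [← show P.map (Prod.map a a) = P from ha]
    rw [Multiset.map_map]
    conv_rhs => rw [← Multiset.map_id P]
    exact Multiset.map_congr rfl fun p _ => by simp [Prod.map]

/-- Pairs that exhibit the lattice as a direct summand of a permutation module with orbits of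
lengths 1, 4 and 10. -/
def reproducingPairs : List (Coords × Coords) :=
  [((-3, 1, 1, 1, 1, 1, 1, 1, 1), (2, 0, -1, -1, -1, -1, -1, -1, -1)),
   ((3, -2, -1, -1, -1, -1, -1, 0, -1), (0, 1, 0, 0, 0, 0, 0, -1, 0)),
   ((3, -2, -1, -1, -1, -1, -1, -1, 0), (0, 1, 0, 0, 0, 0, 0, 0, -1)),
   ((1, 0, 0, 0, 0, 0, 0, -1, -1), (2, -1, -1, -1, -1, -1, -1, 0, 0)),
   ((0, 1, 0, 0, 0, 0, 0, 0, 0), (3, -2, -1, -1, -1, -1, -1, -1, -1)),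
   ((1, -1, 0, 0, 0, 0, -1, 0, 0), (1, -1, -1, 0, -1, 0, 0, 0, 0)),
   ((1, -1, 0, 0, 0, -1, 0, 0, 0), (1, -1, 0, -1, 0, 0, -1, 0, 0)),
   ((1, -1, 0, 0, -1, 0, 0, 0, 0), (1, -1, -1, 0, 0, -1, 0, 0, 0)),
   ((1, -1, 0, -1, 0, 0, 0, 0, 0), (1, -1, 0, 0, -1, 0, -1, 0, 0)),
   ((1, -1, -1, 0, 0, 0, 0, 0, 0), (1, -1, 0, -1, 0, -1, 0, 0, 0)),
   ((0, 0, 1, 0, 0, 0, 0, 0, 0), (-1, 1, 0, 0, 1, 0, 1, 0, 0)),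
   ((0, 0, 0, 1, 0, 0, 0, 0, 0), (-1, 1, 1, 0, 0, 1, 0, 0, 0)),
   ((0, 0, 0, 0, 1, 0, 0, 0, 0), (-1, 1, 0, 1, 0, 0, 1, 0, 0)),
   ((0, 0, 0, 0, 0, 1, 0, 0, 0), (-1, 1, 1, 0, 1, 0, 0, 0, 0)),
   ((0, 0, 0, 0, 0, 0, 1, 0, 0), (-1, 1, 0, 1, 0, 1, 0, 0, 0))]

/-- The pairs of lattice vectors given by `reproducingPairs`. -/
def reproducingFamily : Multiset (V × V) := ↑(reproducingPairs.map (Prod.map toVec toVec))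

theorem mem_pairStabilizer_of_perm {g : LatAut} {f : Coords → Coords}
    (hgf : ∀ t, g (toVec t) = toVec (f t))
    (hf : (reproducingPairs.map (Prod.map f f)).Perm reproducingPairs) :
    g ∈ pairStabilizer reproducingFamily := by
  have h : Prod.map g g ∘ Prod.map toVec toVec = Prod.map toVec toVec ∘ Prod.map f f := by
    funext p; simp [Prod.map, hgf]
  change Multiset.map (Prod.map g g) ↑(reproducingPairs.map (Prod.map toVec toVec)) =
    ↑(reproducingPairs.map (Prod.map toVec toVec))
  rw [Multiset.map_coe, Multiset.coe_eq_coe, List.map_map, h, ← List.map_map]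
  exact hf.map _

theorem reproducingFamily_sum (x : V) :
    (reproducingFamily.map fun p => bil p.2 x • p.1).sum = x := by
  simp only [reproducingFamily, reproducingPairs, Multiset.map_coe, Multiset.sum_coe,
    List.map_cons, List.map_nil, List.sum_cons, List.sum_nil, Prod.map_apply, bil_eq_sum]
  ext i
  simp only [Pi.add_apply, Pi.smul_apply, Pi.zero_apply, smul_eq_mul, toVec, Matrix.cons_val]
  fin_cases i <;> simp <;> ring

theorem condH1_dihedral : CondH1 dihedralHom.range := by
  have : Finite dihedralHom.range := Set.finite_range dihedralHom
  refine condH1_of_reproducing _ reproducingFamily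
    range_dihedralHom_le_W ?_ reproducingFamily_sum
  exact range_dihedralHom_le (pairStabilizer reproducingFamily)
    (mem_pairStabilizer_of_perm rotAut_toVec (by decide +kernel))
    (mem_pairStabilizer_of_perm reflAut_toVec (by decide +kernel))

theorem exists_fixed_conic : ∃ C, IsConic C ∧ ∀ g ∈ dihedralHom.range, g C = C := by
  refine ⟨toVec (1, -1, 0, 0, 0, 0, 0, 0, 0), ⟨?_, ?_⟩, fun g hg => ?_⟩
  · rw [bil_toVec]; decide
  · rw [Kvec_eq_toVec, bil_toVec]; decide
  · refine (range_dihedralHom_le (stab ⊤ (toVec (1, -1, 0, 0, 0, 0, 0, 0, 0)))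
      ⟨trivial, ?_⟩ ⟨trivial, ?_⟩ hg).2
    · rw [rotAut_toVec]; rfl
    · rw [reflAut_toVec]; rfl

theorem exists_dp1_D10_conic :
    ∃ G : Subgroup LatAut, G ≤ W ∧
      Nonempty (G ≃* DihedralGroup 10) ∧
      (orbs G).ncard = 23 ∧
      {S ∈ orbs G | S.ncard = 2}.ncard = 4 ∧
      {S ∈ orbs G | S.ncard = 4}.ncard = 3 ∧
      {S ∈ orbs G | S.ncard = 5}.ncard = 4 ∧
      {S ∈ orbs G | S.ncard = 10}.ncard = 4 ∧
      {S ∈ orbs G | S.ncard = 20}.ncard = 8 ∧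
      MinimalAction G ∧
      (∃ C, IsConic C ∧ ∀ g ∈ G, g C = C) ∧
      CondH1 G := by
  refine ⟨dihedralHom.range, range_dihedralHom_le_W,
    ⟨(MonoidHom.ofInjective dihedralHom_injective).symm⟩, ?_, ?_, ?_, ?_, ?_, ?_,
    minimalAction_dihedral, exists_fixed_conic, condH1_dihedral⟩
  · rw [ncard_orbs]; decide +kernel
  all_goals rw [ncard_orbs_of_ncard]; decide +kernel

end
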